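/- arXiv:2508.19095 — 3 statements merged into one kernel-verified Lean document; each statement's English description precedes it below -/
import Mathlib

section
/- Let M ≥ 1, p ≥ 1 and n_∞ ≥ 1 be integers with p + n_∞ = 2M. Let z_1, …, z_p be pairwise distinct complex numbers, let a_1, …, a_p be complex numbers, and let ξ_0, …, ξ_{n_∞−1} be complex numbers. Suppose R_1 and R_2 are both rational functions of the form R(z) = Σ_{j=1}^M c_j/(z + λ_j) (with c_j ∈ ℂ and pairwise distinct λ_j ∈ ℂ), such that for each i ∈ {1,2}: (a) none of the points z_1, …, z_p is a pole of R_i and R_i(z_j) = a_j for j = 1, …, p, and (b) R_i(z) − Σ_{j=0}^{n_∞−1} ξ_j z^{−j−1} = O(|z|^{−n_∞−1}) as |z| → ∞. Then R_1 and R_2 are equal as rational functions (they agree at every point that is not a pole). -/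
open Asymptotics Bornology Filter

open Polynomial in
/-- A sum of simple fractions is a quotient of polynomials whose denominator has degree at most
the number of terms and vanishes exactly at the poles carrying a nonzero coefficient. -/
lemma exists_polynomial_quotient_of_simple_fractions {M : ℕ} (c l : Fin M → ℂ) :
    ∃ N D : ℂ[X], D.natDegree ≤ M ∧
      (∀ w, D.eval w ≠ 0 ↔ ∀ k, c k ≠ 0 → w + l k ≠ 0) ∧
      ∀ w, D.eval w ≠ 0 → N.eval w = D.eval w * ∑ k, c k / (w + l k) := by
  classical
  set q : Fin M → ℂ[X] := fun k ↦ if c k = 0 then 1 else X + C (l k) with hq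
  have hD : ∀ w, (∏ k, q k).eval w ≠ 0 ↔ ∀ k, c k ≠ 0 → w + l k ≠ 0 := fun w ↦ by
    simp only [eval_prod, Finset.prod_ne_zero_iff, Finset.mem_univ, true_imp_iff, hq]
    refine forall_congr' fun k ↦ ?_
    by_cases h : c k = 0 <;> simp [h]
  refine ⟨∑ k, C (c k) * ∏ j ∈ Finset.univ.erase k, q j, ∏ k, q k, ?_, hD, fun w hw ↦ ?_⟩
  · have hdeg : ∀ k ∈ Finset.univ, (q k).natDegree ≤ 1 := fun k _ ↦ by
      by_cases h : c k = 0 <;> simp [hq, h]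
    simpa using (natDegree_prod_le _ _).trans (Finset.sum_le_card_nsmul _ _ _ hdeg)
  · rw [eval_finsetSum, Finset.mul_sum]
    refine Finset.sum_congr rfl fun k _ ↦ ?_
    by_cases h : c k = 0
    · simp [h]
    · have hk : w + l k ≠ 0 := (hD w).1 hw k h
      have hqk : (q k).eval w = w + l k := by simp [hq, h]
      rw [← Finset.mul_prod_erase Finset.univ q (Finset.mem_univ k), eval_mul, eval_mul, eval_C,
        hqk]
      field_simp

open Polynomial in
/-- A complex polynomial growing at most like `‖w‖ ^ (p - 1)` with `p` distinct roots is zero. -/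
lemma eq_zero_of_isBigO_cobounded_of_eval_eq_zero {p : ℕ} {F : ℂ[X]} {z : Fin p → ℂ}
    (hz : Function.Injective z) (hF : ∀ j, F.eval (z j) = 0)
    (hO : F.eval =O[cobounded ℂ] fun w : ℂ ↦ ‖w‖ ^ ((p : ℤ) - 1)) : F = 0 := by
  by_contra hne
  have hdeg : p ≤ F.natDegree := by
    by_contra! hlt
    exact hne (eq_zero_of_natDegree_lt_card_of_eval_eq_zero F hz hF (by simpa using hlt))
  have hX : (fun w : ℂ ↦ w ^ p) =O[cobounded ℂ] F.eval := by
    have := isBigO_cobounded_of_degree_le (P := (X ^ p : ℂ[X])) (Q := F)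
      (by rw [degree_X_pow, degree_eq_natDegree hne]; exact_mod_cast hdeg)
    simpa using this
  have hbdd : (fun w : ℂ ↦ ‖w‖) =O[cobounded ℂ] fun _ ↦ (1 : ℝ) := by
    have hmul := (hX.trans hO).norm_left.mul
      (isBigO_refl (fun w : ℂ ↦ ‖w‖ ^ (1 - (p : ℤ))) (cobounded ℂ))
    refine hmul.congr' ?_ ?_ <;>
      filter_upwards [eventually_ne_cobounded (0 : ℂ)] with w hw
    · rw [norm_pow, ← zpow_natCast, ← zpow_add₀ (norm_ne_zero_iff.2 hw)]
      simp
    · rw [← zpow_add₀ (norm_ne_zero_iff.2 hw)]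
      simp
  exact ((isLittleO_const_id_cobounded (1 : ℝ)).trans_isBigO hbdd.of_norm_left).not_isBigO
    (Frequently.of_forall fun _ ↦ one_ne_zero) (isBigO_refl _ _)

/-- Uniqueness of the multi-point Padé approximant: two rational functions of the form
`R(z) = Σ_{j=1}^M c_j / (z + λ_j)` satisfying the same `p` interpolation conditions and the
same asymptotic expansion at infinity (with `p + n_∞ = 2M`) agree everywhere away from
their poles. -/
theorem stmt_0 (M p n : ℕ) (hM : 1 ≤ M) (hp : 1 ≤ p) (hn : 1 ≤ n)
    (hsum : p + n = 2 * M)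
    (z : Fin p → ℂ) (hz : Function.Injective z)
    (a : Fin p → ℂ) (ξ : Fin n → ℂ)
    (c₁ l₁ c₂ l₂ : Fin M → ℂ)
    (hl₁ : Function.Injective l₁) (hl₂ : Function.Injective l₂)
    (hpole₁ : ∀ (j : Fin p) (k : Fin M), c₁ k ≠ 0 → z j + l₁ k ≠ 0)
    (hpole₂ : ∀ (j : Fin p) (k : Fin M), c₂ k ≠ 0 → z j + l₂ k ≠ 0)
    (hint₁ : ∀ j : Fin p, ∑ k, c₁ k / (z j + l₁ k) = a j)
    (hint₂ : ∀ j : Fin p, ∑ k, c₂ k / (z j + l₂ k) = a j)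
    (hasym₁ : (fun w : ℂ => (∑ k, c₁ k / (w + l₁ k)) - ∑ j : Fin n, ξ j * w ^ (-(j : ℤ) - 1))
      =O[cobounded ℂ] fun w : ℂ => ‖w‖ ^ (-(n : ℤ) - 1))
    (hasym₂ : (fun w : ℂ => (∑ k, c₂ k / (w + l₂ k)) - ∑ j : Fin n, ξ j * w ^ (-(j : ℤ) - 1))
      =O[cobounded ℂ] fun w : ℂ => ‖w‖ ^ (-(n : ℤ) - 1)) :
    ∀ w : ℂ, (∀ k : Fin M, c₁ k ≠ 0 → w + l₁ k ≠ 0) →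
      (∀ k : Fin M, c₂ k ≠ 0 → w + l₂ k ≠ 0) →
      ∑ k, c₁ k / (w + l₁ k) = ∑ k, c₂ k / (w + l₂ k) := by
  obtain ⟨N₁, D₁, hd₁, hD₁, hN₁⟩ := exists_polynomial_quotient_of_simple_fractions c₁ l₁
  obtain ⟨N₂, D₂, hd₂, hD₂, hN₂⟩ := exists_polynomial_quotient_of_simple_fractions c₂ l₂
  have heval : ∀ w, D₁.eval w ≠ 0 → D₂.eval w ≠ 0 → (N₁ * D₂ - N₂ * D₁).eval w =
      (D₁ * D₂).eval w * (∑ k, c₁ k / (w + l₁ k) - ∑ k, c₂ k / (w + l₂ k)) := fun w h₁ h₂ ↦ by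
    simp only [Polynomial.eval_sub, Polynomial.eval_mul, hN₁ w h₁, hN₂ w h₂]
    ring
  have hev : ∀ {c l : Fin M → ℂ}, ∀ᶠ w in cobounded ℂ, ∀ k, c k ≠ 0 → w + l k ≠ 0 :=
    eventually_all.2 fun k ↦ (eventually_ne_cobounded _).mono fun w hw _ h ↦
      hw (eq_neg_of_add_eq_zero_left h)
  have hdiff : (fun w : ℂ ↦ ∑ k, c₁ k / (w + l₁ k) - ∑ k, c₂ k / (w + l₂ k))
      =O[cobounded ℂ] fun w : ℂ ↦ ‖w‖ ^ (-(n : ℤ) - 1) :=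
    (hasym₁.sub hasym₂).congr_left fun w ↦ by ring
  have hden : (D₁ * D₂).eval =O[cobounded ℂ] fun w : ℂ ↦ ‖w‖ ^ (2 * M) := by
    have := Polynomial.isBigO_cobounded_of_degree_le (P := D₁ * D₂)
      (Q := (Polynomial.X ^ (2 * M) : Polynomial ℂ)) (by
        rw [Polynomial.degree_X_pow]
        exact Polynomial.degree_le_of_natDegree_le (Polynomial.natDegree_mul_le.trans (by lia)))
    simpa using this.norm_right
  have hF : N₁ * D₂ - N₂ * D₁ = 0 := by
    refine eq_zero_of_isBigO_cobounded_of_eval_eq_zero hz (fun j ↦ ?_) ?_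
    · rw [heval _ ((hD₁ _).2 (hpole₁ j)) ((hD₂ _).2 (hpole₂ j)), hint₁, hint₂, sub_self, mul_zero]
    · refine (hden.mul hdiff).congr' ?_ ?_
      · filter_upwards [hev, hev] with w h₁ h₂
        exact (heval w ((hD₁ w).2 h₁) ((hD₂ w).2 h₂)).symm
      · filter_upwards [eventually_ne_cobounded (0 : ℂ)] with w hw
        rw [← zpow_natCast, ← zpow_add₀ (norm_ne_zero_iff.2 hw)]
        congr 1
        lia
  intro w h₁ h₂
  have h := heval w ((hD₁ w).2 h₁) ((hD₂ w).2 h₂)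
  rw [hF, Polynomial.eval_zero, Polynomial.eval_mul] at h
  exact sub_eq_zero.1 ((mul_eq_zero.1 h.symm).resolve_left
    (mul_ne_zero ((hD₁ w).2 h₁) ((hD₂ w).2 h₂)))
end

section
/- Let M ≥ 1, p ≥ 1 and n_∞ ≥ 1 be integers with p + n_∞ = 2M. Let z_1, …, z_p be pairwise distinct complex numbers satisfying the symmetry condition z_{p+1−j} = conj(z_j) for all j = 1, …, p, let a_1, …, a_p be complex numbers satisfying a_{p+1−j} = conj(a_j) for all j, and let ξ_0, …, ξ_{n_∞−1} be real numbers. Suppose R is a rational function of the form R(z) = Σ_{j=1}^M c_j/(z + λ_j) (with c_j ∈ ℂ and pairwise distinct λ_j ∈ ℂ) such that none of the points z_1, …, z_p is a pole of R, R(z_j) = a_j for j = 1, …, p, and R(z) − Σ_{j=0}^{n_∞−1} ξ_j z^{−j−1} = O(|z|^{−n_∞−1}) as |z| → ∞. Then R is a real rational function: R(conj(z)) = conj(R(z)) for every z that is not a pole of R; in particular R(x) ∈ ℝ for every real x that is not a pole of R. -/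
open Asymptotics Bornology Filter Complex

section SimplePoles

open Polynomial

variable {ι : Type*}

theorem Polynomial.degree_le_of_isBigO_cobounded {P Q : ℂ[X]}
    (h : P.eval =O[cobounded ℂ] Q.eval) : P.degree ≤ Q.degree := by
  by_contra! hlt
  have hP : P ≠ 0 := by
    rintro rfl
    simp at hlt
  refine isLittleO_irrefl ?_ (h.trans_isLittleO (isLittleO_cobounded_of_degree_lt hlt))
  exact ((eventually_cofinite_not_isRoot hP).filter_mono (le_cofinite ℂ)).frequently

/-- The denominator `∏ (X + λ_k)` of `∑ c_k / (X + λ_k)`. -/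
noncomputable def poleDenom (s : Finset ι) (l : ι → ℂ) : ℂ[X] :=
  ∏ k ∈ s, (X + C (l k))

/-- The numerator of `∑ c_k / (X + λ_k)` over the denominator `poleDenom`. -/
noncomputable def poleNum [DecidableEq ι] (s : Finset ι) (c l : ι → ℂ) : ℂ[X] :=
  ∑ k ∈ s, C (c k) * poleDenom (s.erase k) l

theorem eval_poleDenom (s : Finset ι) (l : ι → ℂ) (w : ℂ) :
    (poleDenom s l).eval w = ∏ k ∈ s, (w + l k) := by
  simp [poleDenom, eval_prod]

theorem poleDenom_monic (s : Finset ι) (l : ι → ℂ) : (poleDenom s l).Monic :=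
  monic_prod_of_monic _ _ fun _ _ => monic_X_add_C _

theorem degree_poleDenom (s : Finset ι) (l : ι → ℂ) : (poleDenom s l).degree = s.card := by
  simp [poleDenom, degree_prod]

theorem eval_poleNum [DecidableEq ι] (s : Finset ι) (c l : ι → ℂ) {w : ℂ}
    (hw : ∀ k ∈ s, w + l k ≠ 0) :
    (poleNum s c l).eval w = (∑ k ∈ s, c k / (w + l k)) * (poleDenom s l).eval w := by
  simp only [poleNum, eval_finsetSum, eval_mul, eval_C, eval_poleDenom, Finset.sum_mul]
  refine Finset.sum_congr rfl fun k hk => ?_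
  rw [← Finset.mul_prod_erase s _ hk]
  field_simp [hw k hk]

theorem eval_poleNum_ne_zero [DecidableEq ι] {s : Finset ι} {c l : ι → ℂ}
    (hl : Function.Injective l) (hc : ∀ k ∈ s, c k ≠ 0) {w : ℂ}
    (hw : (poleDenom s l).eval w = 0) : (poleNum s c l).eval w ≠ 0 := by
  rw [eval_poleDenom, Finset.prod_eq_zero_iff] at hw
  obtain ⟨k, hk, hwk⟩ := hw
  have hval : (poleNum s c l).eval w = c k * ∏ i ∈ s.erase k, (w + l i) := by
    simp only [poleNum, eval_finsetSum, eval_mul, eval_C, eval_poleDenom]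
    refine Finset.sum_eq_single_of_mem k hk fun i _ hik => ?_
    rw [Finset.prod_eq_zero (Finset.mem_erase.2 ⟨hik.symm, hk⟩) hwk, mul_zero]
  rw [hval]
  refine mul_ne_zero (hc k hk) (Finset.prod_ne_zero_iff.2 fun i hi hwi => ?_)
  exact Finset.ne_of_mem_erase hi (hl (add_left_cancel (hwi.trans hwk.symm)))

theorem eventually_cobounded_add_ne_zero (s : Finset ι) (l : ι → ℂ) :
    ∀ᶠ w in cobounded ℂ, ∀ k ∈ s, w + l k ≠ 0 := by
  have h := (eventually_cofinite_not_isRoot (poleDenom_monic s l).ne_zero).filter_mono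
    (le_cofinite ℂ)
  filter_upwards [h] with w hw k hk hwk
  exact hw (by rw [IsRoot, eval_poleDenom]; exact Finset.prod_eq_zero hk hwk)

/-- Two functions with at most `M` simple poles that agree at `p` points and to order `n` at
infinity, where `p + n = 2 * M`, have proportional numerators and denominators. -/
theorem poleNum_mul_poleDenom_eq [DecidableEq ι] {M p n : ℕ} (hp : 1 ≤ p)
    (hsum : p + n = 2 * M) {s : Finset ι} (hs : s.card ≤ M) {c l c' l' : ι → ℂ}
    {z : Fin p → ℂ} (hz : Function.Injective z)
    (hpole : ∀ j, ∀ k ∈ s, z j + l k ≠ 0) (hpole' : ∀ j, ∀ k ∈ s, z j + l' k ≠ 0)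
    (heq : ∀ j, ∑ k ∈ s, c k / (z j + l k) = ∑ k ∈ s, c' k / (z j + l' k))
    (hO : (fun w : ℂ => (∑ k ∈ s, c k / (w + l k)) - ∑ k ∈ s, c' k / (w + l' k))
      =O[cobounded ℂ] fun w : ℂ => ‖w‖ ^ (-(n : ℤ) - 1)) :
    poleNum s c l * poleDenom s l' = poleNum s c' l' * poleDenom s l := by
  have hden (m : ι → ℂ) : (poleDenom s m).eval =O[cobounded ℂ] fun w : ℂ => ‖w‖ ^ (M : ℤ) := by
    have h : (poleDenom s m).degree ≤ (X ^ M : ℂ[X]).degree := by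
      rw [degree_poleDenom, degree_X_pow]
      exact_mod_cast hs
    refine (isBigO_cobounded_of_degree_le h).trans (IsBigO.of_norm_left ?_)
    simpa using isBigO_refl (fun w : ℂ => ‖w‖ ^ M) (cobounded ℂ)
  have hbig : (poleNum s c l * poleDenom s l' - poleNum s c' l' * poleDenom s l).eval
      =O[cobounded ℂ] (X ^ (p - 1) : ℂ[X]).eval := by
    refine ((hO.mul (hden l)).mul (hden l')).congr' ?_ ?_ |>.trans
      (isBigO_refl (fun w : ℂ => ‖w‖ ^ (p - 1)) (cobounded ℂ)) |>.trans
      (IsBigO.of_norm_right ?_)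
    · filter_upwards [eventually_cobounded_add_ne_zero s l,
        eventually_cobounded_add_ne_zero s l'] with w hw hw'
      rw [eval_sub, eval_mul, eval_mul, eval_poleNum s c l hw, eval_poleNum s c' l' hw']
      ring
    · filter_upwards [eventually_ne_cobounded (0 : ℂ)] with w hw
      have hw0 : ‖w‖ ≠ 0 := norm_ne_zero_iff.2 hw
      rw [← zpow_add₀ hw0, ← zpow_add₀ hw0, ← zpow_natCast]
      congr 1
      omega
    · simpa using isBigO_refl (fun w : ℂ => ‖w‖ ^ (p - 1)) (cobounded ℂ)
  have hdeg := degree_le_of_isBigO_cobounded hbig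
  rw [degree_X_pow] at hdeg
  refine sub_eq_zero.1 (eq_zero_of_natDegree_lt_card_of_eval_eq_zero _ hz (fun j => ?_) ?_)
  · rw [eval_sub, eval_mul, eval_mul, eval_poleNum s c l (hpole j),
      eval_poleNum s c' l' (hpole' j), heq j]
    ring
  · rw [Fintype.card_fin]
    have := natDegree_le_of_degree_le hdeg
    omega

/-- If the numerators and denominators of two sums of simple fractions are proportional, then
the sums agree away from the poles of the first one. -/
theorem sum_div_eq_of_poleNum_mul_poleDenom_eq [DecidableEq ι] {s : Finset ι}
    {c l c' l' : ι → ℂ} (hl' : Function.Injective l') (hc' : ∀ k ∈ s, c' k ≠ 0)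
    (h : poleNum s c l * poleDenom s l' = poleNum s c' l' * poleDenom s l) {w : ℂ}
    (hw : ∀ k ∈ s, w + l k ≠ 0) :
    ∑ k ∈ s, c k / (w + l k) = ∑ k ∈ s, c' k / (w + l' k) := by
  have hQ : (poleDenom s l).eval w ≠ 0 := by
    rw [eval_poleDenom]
    exact Finset.prod_ne_zero_iff.2 hw
  have hev := congrArg (eval w) h
  rw [eval_mul, eval_mul] at hev
  have hQ' : (poleDenom s l').eval w ≠ 0 := fun h0 => by
    rw [h0, mul_zero] at hev
    exact mul_ne_zero (eval_poleNum_ne_zero hl' hc' h0) hQ hev.symm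
  have hw' : ∀ k ∈ s, w + l' k ≠ 0 := by
    rw [eval_poleDenom] at hQ'
    exact Finset.prod_ne_zero_iff.1 hQ'
  rw [eval_poleNum s c l hw, eval_poleNum s c' l' hw'] at hev
  refine mul_right_cancel₀ (mul_ne_zero hQ hQ') ?_
  linear_combination hev

end SimplePoles

/-- If the interpolation data satisfies the conjugate-symmetry conditions
`z_{p+1-j} = conj z_j`, `a_{p+1-j} = conj a_j` and the expansion coefficients `ξ_j`
are real, then the (unique) multi-point Padé approximant
`R(z) = Σ_{j=1}^M c_j / (z + λ_j)` is a real rational function: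
`R(conj w) = conj (R w)` away from poles, and `R(x)` is real for real `x` away
from poles. -/
theorem stmt_1 (M p n : ℕ) (hM : 1 ≤ M) (hp : 1 ≤ p) (hn : 1 ≤ n)
    (hsum : p + n = 2 * M)
    (z : Fin p → ℂ) (hz : Function.Injective z)
    (hzsym : ∀ j : Fin p, z j.rev = starRingEnd ℂ (z j))
    (a : Fin p → ℂ)
    (hasym' : ∀ j : Fin p, a j.rev = starRingEnd ℂ (a j))
    (ξ : Fin n → ℝ)
    (c l : Fin M → ℂ) (hl : Function.Injective l)
    (hpole : ∀ (j : Fin p) (k : Fin M), c k ≠ 0 → z j + l k ≠ 0)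
    (hint : ∀ j : Fin p, ∑ k, c k / (z j + l k) = a j)
    (hasym : (fun w : ℂ => (∑ k, c k / (w + l k)) - ∑ j : Fin n, (ξ j : ℂ) * w ^ (-(j : ℤ) - 1))
      =O[cobounded ℂ] fun w : ℂ => ‖w‖ ^ (-(n : ℤ) - 1)) :
    (∀ w : ℂ, (∀ k : Fin M, c k ≠ 0 → w + l k ≠ 0) →
        ∑ k, c k / (starRingEnd ℂ w + l k) = starRingEnd ℂ (∑ k, c k / (w + l k))) ∧
    (∀ x : ℝ, (∀ k : Fin M, c k ≠ 0 → (x : ℂ) + l k ≠ 0) →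
        ∃ r : ℝ, ∑ k, c k / ((x : ℂ) + l k) = (r : ℂ)) := by
  classical
  have hconj (w : ℂ) : ∑ k, starRingEnd ℂ (c k) / (w + starRingEnd ℂ (l k)) =
      starRingEnd ℂ (∑ k, c k / (starRingEnd ℂ w + l k)) := by
    simp
  set s : Finset (Fin M) := Finset.univ.filter fun k => c k ≠ 0 with hs
  have hmem (k : Fin M) : k ∈ s ↔ c k ≠ 0 := by simp [hs]
  have hsupp (d : Fin M → ℂ) (f : Fin M → ℂ) (hd : ∀ k, c k = 0 → d k = 0) :
      ∑ k ∈ s, d k / f k = ∑ k, d k / f k := by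
    refine Finset.sum_subset (Finset.subset_univ s) fun k _ hk => ?_
    rw [hd k (by simpa [hmem] using hk), zero_div]
  have hsum_s (w : ℂ) : ∑ k ∈ s, c k / (w + l k) = ∑ k, c k / (w + l k) :=
    hsupp c _ fun _ h => h
  have hsum_s' (w : ℂ) : ∑ k ∈ s, starRingEnd ℂ (c k) / (w + starRingEnd ℂ (l k)) =
      starRingEnd ℂ (∑ k, c k / (starRingEnd ℂ w + l k)) := by
    rw [← hconj]
    exact hsupp (fun k => starRingEnd ℂ (c k)) _ fun k h => by simp [h]
  have hasym_conj : (fun w : ℂ => starRingEnd ℂ (∑ k, c k / (starRingEnd ℂ w + l k)) -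
      ∑ j : Fin n, (ξ j : ℂ) * w ^ (-(j : ℤ) - 1))
      =O[cobounded ℂ] fun w : ℂ => ‖w‖ ^ (-(n : ℤ) - 1) := by
    have htend : Tendsto (starRingEnd ℂ) (cobounded ℂ) (cobounded ℂ) := by
      rw [← tendsto_norm_atTop_iff_cobounded]
      simpa using tendsto_norm_cobounded_atTop (E := ℂ)
    refine IsBigO.of_norm_left (((hasym.comp_tendsto htend).norm_left).congr (fun w => ?_)
      fun w => ?_)
    · rw [Function.comp_apply, ← Complex.norm_conj]
      simp
    · simp
  have hcross := poleNum_mul_poleDenom_eq (s := s) (c := c) (l := l)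
    (c' := fun k => starRingEnd ℂ (c k)) (l' := fun k => starRingEnd ℂ (l k)) hp hsum
    (by simpa using Finset.card_le_univ s) hz
    (fun j k hk => hpole j k ((hmem k).1 hk))
    (fun j k hk h => hpole j.rev k ((hmem k).1 hk) (by
      rw [hzsym, ← Complex.conj_conj (l k), ← map_add, h, map_zero]))
    (fun j => by
      rw [hsum_s, hsum_s', ← hzsym, hint, hint, hasym', Complex.conj_conj])
    (by
      simp only [hsum_s, hsum_s']
      exact (hasym.sub hasym_conj).congr_left fun w => by ring)
  have main (w : ℂ) (hw : ∀ k : Fin M, c k ≠ 0 → w + l k ≠ 0) :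
      ∑ k, c k / (w + l k) = starRingEnd ℂ (∑ k, c k / (starRingEnd ℂ w + l k)) := by
    rw [← hsum_s, ← hsum_s']
    exact sum_div_eq_of_poleNum_mul_poleDenom_eq
      (fun i j hij => hl ((starRingEnd ℂ).injective hij))
      (fun k hk => (map_ne_zero _).2 ((hmem k).1 hk)) hcross
      fun k hk => hw k ((hmem k).1 hk)
  refine ⟨fun w hw => ?_, fun x hx => ?_⟩
  · rw [main w hw, Complex.conj_conj]
  · have h := main x hx
    rw [Complex.conj_ofReal] at h
    obtain ⟨r, hr⟩ := Complex.conj_eq_iff_real.1 h.symm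
    exact ⟨r, hr⟩
end

section
/- Let g : ℝ → ℂ be a continuous function with g(x) = 0 for all x < 0, and let c > 0 be a real number such that x ↦ e^{−cx} g(x) is integrable on ℝ. Define L(z) := ∫_0^∞ g(x) e^{−zx} dx for Re(z) ≥ c, and assume that y ↦ L(c + iy) is integrable on ℝ. Then for every x ∈ ℝ, |g(x)| ≤ (e^{cx}/(2π)) ∫_ℝ |L(c + iy)| dy. -/
open MeasureTheory Set Complex Real

open scoped FourierTransform in
/-- A continuous integrable function with integrable Fourier transform is bounded by the
`L¹` norm of its Fourier transform. -/
theorem norm_le_integral_norm_fourier {f : ℝ → ℂ} (h : Continuous f) (hf : Integrable f)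
    (h'f : Integrable (𝓕 f)) (x : ℝ) : ‖f x‖ ≤ ∫ w : ℝ, ‖𝓕 f w‖ := by
  rw [← congrFun (h.fourierInv_fourier_eq hf h'f) x, Real.fourierInv_eq]
  refine (norm_integral_le_integral_norm _).trans_eq ?_
  simp only [Circle.norm_smul]

open scoped FourierTransform in
/-- The Fourier transform of `e^{-cx} g(x)`, for `g` vanishing on `(-∞,0)`, is the Laplace
transform of `g` along the line `c + iℝ`, rescaled by `2π`. -/
theorem fourier_exp_smul_eq_laplace {g : ℝ → ℂ} (hg0 : ∀ x < (0 : ℝ), g x = 0) (c w : ℝ) :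
    𝓕 (fun x : ℝ => Real.exp (-c * x) • g x) w =
      ∫ x in Set.Ioi (0 : ℝ), g x * Complex.exp (-(c + (2 * π * w : ℝ) * Complex.I) * x) := by
  rw [Real.fourier_real_eq_integral_exp_smul, ← integral_Ici_eq_integral_Ioi,
    setIntegral_eq_integral_of_forall_compl_eq_zero
      fun x hx => by simp [hg0 x (not_le.mp hx)]]
  congr 1 with x
  rw [Complex.real_smul, smul_eq_mul, Complex.ofReal_exp, ← mul_assoc, ← Complex.exp_add,
    mul_comm]
  congr 2
  push_cast
  ring

/-- Laplace inversion bound: if `g : ℝ → ℂ` is continuous, vanishes on `(-∞,0)`, and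
`x ↦ e^{-cx} g(x)` is integrable on `ℝ` for some `c > 0`, and if the Laplace transform
`L(z) = ∫_0^∞ g(x) e^{-zx} dx` is integrable on the vertical line `c + iℝ`, then
`|g(x)| ≤ (e^{cx}/(2π)) ∫_ℝ |L(c+iy)| dy` for every `x`. -/
theorem stmt_5 (g : ℝ → ℂ) (hg : Continuous g) (hg0 : ∀ x < (0 : ℝ), g x = 0)
    (c : ℝ) (hc : 0 < c)
    (hint : Integrable (fun x : ℝ => Real.exp (-c * x) • g x))
    (L : ℂ → ℂ)
    (hL : ∀ z : ℂ, c ≤ z.re → L z = ∫ x in Set.Ioi (0 : ℝ), g x * Complex.exp (-z * x))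
    (hLint : Integrable (fun y : ℝ => L (c + y * Complex.I))) :
    ∀ x : ℝ, ‖g x‖ ≤ Real.exp (c * x) / (2 * π) * ∫ y : ℝ, ‖L (c + y * Complex.I)‖ := by
  intro x
  have hF : FourierTransform.fourier (fun x : ℝ => Real.exp (-c * x) • g x) =
      fun w : ℝ => L (c + (2 * π * w : ℝ) * Complex.I) := by
    ext w
    rw [fourier_exp_smul_eq_laplace hg0, hL _ (by simp)]
  have hFint : Integrable (fun w : ℝ => L (c + (2 * π * w : ℝ) * Complex.I)) :=
    hLint.comp_mul_left' Real.two_pi_pos.ne'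
  have hbound := norm_le_integral_norm_fourier (by fun_prop) hint (hF ▸ hFint) x
  rw [hF, Measure.integral_comp_mul_left (fun y : ℝ => ‖L (c + y * Complex.I)‖) (2 * π),
    abs_of_pos (inv_pos.mpr Real.two_pi_pos), norm_smul, Real.norm_of_nonneg (Real.exp_pos _).le,
    smul_eq_mul] at hbound
  calc ‖g x‖ = Real.exp (c * x) * (Real.exp (-c * x) * ‖g x‖) := by
        rw [← mul_assoc, ← Real.exp_add]; simp
    _ ≤ Real.exp (c * x) * ((2 * π)⁻¹ * ∫ y : ℝ, ‖L (c + y * Complex.I)‖) := by gcongr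
    _ = _ := by ring
end
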